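/- Let d ≥ 3, p ∈ [1,∞] with conjugate p* (1/p + 1/p* = 1), f L-Lipschitz w.r.t. ℓ_q, x ∈ ℝ^d, h > 0, ζ uniform on S_1^d, and g = (d/(2h))(f(x + hζ) - f(x - hζ)) sign(ζ). Then E[||g||_{p*}^2] ≤ 12(1+√2)^2 L^2 d^{1 + 2/(q∧2) - 2/p}. -/

import Mathlib

open MeasureTheory ProbabilityTheory ENNReal

noncomputable def laplaceMeasure : Measure ℝ :=
  volume.withDensity (fun w => ENNReal.ofReal ((1 / 2) * Real.exp (-|w|)))

/-- The uniform distribution on the ℓ¹-sphere `S₁ᵈ`, realized as the law of `W/‖W‖₁`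
for `W` a vector of i.i.d. mean-0 scale-1 Laplace random variables (Schechtman–Zinn). -/
noncomputable def sphereUniform (d : ℕ) : Measure (Fin d → ℝ) :=
  Measure.map (fun w => (∑ i, |w i|)⁻¹ • w) (Measure.pi fun _ : Fin d => laplaceMeasure)

/-- The coordinatewise sign function (with `sign 0 = 1`). -/
noncomputable def signVec {d : ℕ} (x : Fin d → ℝ) : Fin d → ℝ :=
  fun i => if x i < 0 then -1 else 1

lemma lap_integral (φ : ℝ → ℝ) :
    ∫ w, φ w ∂laplaceMeasure = ∫ w, (1 / 2) * Real.exp (-|w|) * φ w := by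
  unfold laplaceMeasure
  rw [integral_withDensity_eq_integral_toReal_smul (by fun_prop)
    (Filter.Eventually.of_forall fun _ => ENNReal.ofReal_lt_top)]
  refine integral_congr_ae (Filter.Eventually.of_forall fun w => ?_)
  simp only [smul_eq_mul]
  rw [ENNReal.toReal_ofReal (by positivity)]

lemma lap_integrable_iff (φ : ℝ → ℝ) :
    Integrable φ laplaceMeasure ↔ Integrable (fun w => (1 / 2) * Real.exp (-|w|) * φ w) := by
  unfold laplaceMeasure
  rw [integrable_withDensity_iff_integrable_smul' (by fun_prop)
    (Filter.Eventually.of_forall fun _ => ENNReal.ofReal_lt_top)]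
  refine integrable_congr (Filter.Eventually.of_forall fun w => ?_)
  simp only [smul_eq_mul]
  rw [ENNReal.toReal_ofReal (by positivity)]

lemma integrable_exp_abs : Integrable (fun w : ℝ => Real.exp (-(|w| / 2))) := by
  have h := integrable_fun_norm_addHaar (E := ℝ) volume (f := fun w : ℝ => Real.exp (-(w / 2)))
  simp only [Real.norm_eq_abs] at h
  rw [h]
  have := integrableOn_exp_mul_Ioi (a := -(1/2)) (by norm_num) 0
  refine this.congr_fun (fun x hx => ?_) measurableSet_Ioi
  simp; ring

lemma lap_integrable_exp : Integrable (fun w : ℝ => Real.exp (|w| / 2)) laplaceMeasure := by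
  rw [lap_integrable_iff]
  refine (integrable_exp_abs.const_mul (1/2)).congr (Filter.Eventually.of_forall fun w => ?_)
  simp only [mul_assoc, ← Real.exp_add]
  congr 2; ring

lemma lap_half (φ : ℝ → ℝ) (hφ : Integrable φ laplaceMeasure) :
    ∫ w, φ w ∂laplaceMeasure
      = (1 / 2) * (∫ w in Set.Ioi (0:ℝ), Real.exp (-w) * φ w)
        + (1 / 2) * ∫ w in Set.Ioi (0:ℝ), Real.exp (-w) * φ (-w) := by
  rw [lap_integral]
  rw [lap_integrable_iff] at hφ
  rw [← intervalIntegral.integral_Iic_add_Ioi (b := 0) hφ.integrableOn hφ.integrableOn, add_comm]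
  congr 1
  · rw [← integral_const_mul]
    refine setIntegral_congr_fun measurableSet_Ioi fun w hw => ?_
    beta_reduce; rw [abs_of_pos hw]; ring
  · have := integral_comp_neg_Ioi (0:ℝ) (fun w => (1 / 2) * Real.exp (-|w|) * φ w)
    rw [neg_zero] at this
    rw [← this, ← integral_const_mul]
    refine setIntegral_congr_fun measurableSet_Ioi fun w hw => ?_
    beta_reduce; rw [abs_neg, abs_of_pos hw]; ring

lemma lap_half_integrable (φ : ℝ → ℝ) (hφ : Integrable φ laplaceMeasure) :
    IntegrableOn (fun w => Real.exp (-w) * φ w) (Set.Ioi (0:ℝ)) := by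
  rw [lap_integrable_iff] at hφ
  refine IntegrableOn.congr_fun (f := fun w => 2 * (1 / 2 * Real.exp (-|w|) * φ w))
    ((hφ.integrableOn (s := Set.Ioi 0)).const_mul 2) (fun w hw => ?_) measurableSet_Ioi
  beta_reduce; rw [abs_of_pos hw]; ring

lemma lap_moment_aux (n : ℕ) : ∫ w in Set.Ioi (0:ℝ), Real.exp (-w) * w ^ n = n.factorial := by
  have := Real.Gamma_eq_integral (s := n + 1) (by positivity)
  rw [Real.Gamma_nat_eq_factorial] at this
  rw [this]
  refine setIntegral_congr_fun measurableSet_Ioi fun w hw => ?_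
  simp

instance lap_finite : IsFiniteMeasure laplaceMeasure := by
  have h : Integrable (fun _ : ℝ => (1:ℝ)) laplaceMeasure := by
    refine lap_integrable_exp.mono' (by fun_prop) (Filter.Eventually.of_forall fun w => ?_)
    simp; positivity
  rw [integrable_const_iff] at h
  simpa using h

lemma poly_le_exp {r : ℝ} (hr : 0 ≤ r) : r ^ 4 ≤ 384 * Real.exp (r / 2) := by
  have := Real.pow_div_factorial_le_exp (r / 2) (by positivity) 4
  norm_num [Nat.factorial] at this
  nlinarith

lemma lap_integrable_of_bound (φ : ℝ → ℝ) (hφ : AEStronglyMeasurable φ laplaceMeasure) (C D : ℝ)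
    (hC : 0 ≤ C) (hD : 0 ≤ D) (hb : ∀ w, |φ w| ≤ C * (D + |w|) ^ 4) :
    Integrable φ laplaceMeasure := by
  refine (lap_integrable_exp.const_mul (C * (384 * Real.exp (D / 2)))).mono' hφ
    (Filter.Eventually.of_forall fun w => (hb w).trans ?_)
  have := poly_le_exp (r := D + |w|) (by positivity)
  rw [add_div, Real.exp_add] at this
  calc _ ≤ _ := mul_le_mul_of_nonneg_left this hC
    _ = _ := by ring

lemma lap_integrable_pow (n : ℕ) (hn : n ≤ 4) :
    Integrable (fun w => |w| ^ n) laplaceMeasure := by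
  refine lap_integrable_of_bound _ (by fun_prop) 1 1 zero_le_one zero_le_one fun w => ?_
  rw [abs_of_nonneg (by positivity), one_mul]
  calc |w| ^ n ≤ (1 + |w|) ^ n := by gcongr; linarith
    _ ≤ _ := pow_le_pow_right₀ (by linarith [abs_nonneg w]) hn

lemma lap_moment (n : ℕ) (hn : n ≤ 4) : ∫ w, |w| ^ n ∂laplaceMeasure = n.factorial := by
  rw [lap_half _ (lap_integrable_pow n hn)]
  simp only [abs_neg]
  have : ∫ w in Set.Ioi (0:ℝ), Real.exp (-w) * |w| ^ n = n.factorial := by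
    rw [← lap_moment_aux]
    refine setIntegral_congr_fun measurableSet_Ioi fun w hw => ?_
    beta_reduce; rw [abs_of_pos hw]
  rw [this]; ring

instance lap_prob : IsProbabilityMeasure laplaceMeasure := by
  have := lap_moment 0 (by norm_num)
  simp at this
  constructor
  rw [Measure.real] at this
  rw [← ENNReal.toReal_eq_one_iff]; exact this

lemma lap_map_neg : laplaceMeasure.map Neg.neg = laplaceMeasure := by
  ext s hs
  rw [Measure.map_apply measurable_neg hs]
  unfold laplaceMeasure
  rw [withDensity_apply _ hs, withDensity_apply _ (measurable_neg hs)]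
  rw [← lintegral_indicator hs, ← lintegral_indicator (measurable_neg hs),
    ← lintegral_neg_eq_self]
  congr 1; ext w
  have hm : -w ∈ Neg.neg ⁻¹' s ↔ w ∈ s := by
    change - -w ∈ s ↔ w ∈ s
    rw [neg_neg]
  by_cases h : w ∈ s
  · rw [Set.indicator_of_mem h, Set.indicator_of_mem (hm.2 h), abs_neg]
  · rw [Set.indicator_of_notMem h, Set.indicator_of_notMem (fun h' => h (hm.1 h'))]

instance lap_neg : laplaceMeasure.IsNegInvariant := ⟨lap_map_neg⟩

lemma lap_ac : laplaceMeasure ≪ volume := withDensity_absolutelyContinuous _ _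

lemma half_poincare (g : ℝ → ℝ) (K : NNReal) (hg : LipschitzWith K g) (g0 : g 0 = 0)
    (h1 : IntegrableOn (fun w => Real.exp (-w) * g w ^ 2) (Set.Ioi (0:ℝ)))
    (h2 : IntegrableOn (fun w => Real.exp (-w) * deriv g w ^ 2) (Set.Ioi (0:ℝ))) :
    ∫ w in Set.Ioi (0:ℝ), Real.exp (-w) * g w ^ 2
      ≤ 4 * ∫ w in Set.Ioi (0:ℝ), Real.exp (-w) * deriv g w ^ 2 := by
  set H : ℝ → ℝ := fun w => 2 * (Real.exp (-w) * deriv g w ^ 2) - (1/2) * (Real.exp (-w) * g w ^ 2)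
    with hH
  have hHi : IntegrableOn H (Set.Ioi (0:ℝ)) := (h2.const_mul 2).sub (h1.const_mul (1/2))
  have key : ∀ T : ℝ, 0 ≤ T → 0 ≤ ∫ w in (0:ℝ)..T, H w := by
    intro T hT
    have a1 : AbsolutelyContinuousOnInterval g 0 T :=
      (hg.lipschitzOnWith (s := Set.uIcc 0 T)).absolutelyContinuousOnInterval
    have a2 : AbsolutelyContinuousOnInterval (fun w => g w * g w) 0 T := a1.fun_mul a1
    have a3 : AbsolutelyContinuousOnInterval (fun w => Real.exp (-w)) 0 T :=
      ContDiffOn.absolutelyContinuousOnInterval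
        (ContDiff.contDiffOn (by fun_prop))
    have e := a2.integral_deriv_mul_eq_sub a3
    rw [g0] at e
    have e' : 0 ≤ g T * g T * Real.exp (-T) - 0 * 0 * Real.exp (-0) := by
      have := mul_self_nonneg (g T)
      simp; positivity
    rw [← e] at e'
    refine e'.trans (intervalIntegral.integral_mono_ae hT ?_ ?_ ?_)
    · exact (a2.intervalIntegrable_deriv.mul_continuousOn a3.continuousOn).add
        (a3.intervalIntegrable_deriv.continuousOn_mul a2.continuousOn)
    · rw [intervalIntegrable_iff_integrableOn_Ioc_of_le hT]
      exact hHi.mono_set Set.Ioc_subset_Ioi_self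
    · filter_upwards [hg.ae_differentiableAt_real] with w hw
      have d1 : deriv (fun w => g w * g w) w = deriv g w * g w + g w * deriv g w :=
        (hw.hasDerivAt.mul hw.hasDerivAt).deriv
      have d2 : deriv (fun w => Real.exp (-w)) w = - Real.exp (-w) := by
        have := ((hasDerivAt_neg w).exp).deriv
        simpa using this
      simp only [hH]
      rw [d1, d2]
      have := mul_nonneg (Real.exp_pos (-w)).le (sq_nonneg (g w - 2 * deriv g w))
      nlinarith
  have lim := intervalIntegral_tendsto_integral_Ioi 0 hHi Filter.tendsto_id
  have := ge_of_tendsto lim ((Filter.eventually_ge_atTop 0).mono key)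
  rw [hH, integral_sub (h2.const_mul 2) (h1.const_mul (1/2)), integral_const_mul,
    integral_const_mul] at this
  linarith

lemma lap_poincare (g : ℝ → ℝ) (K : NNReal) (hg : LipschitzWith K g) :
    ∫ w, g w ^ 2 ∂laplaceMeasure - (∫ w, g w ∂laplaceMeasure) ^ 2
      ≤ 4 * ∫ w, deriv g w ^ 2 ∂laplaceMeasure := by
  have hK : (0:ℝ) ≤ K := K.2
  have bd : ∀ w, |g w| ≤ |g 0| + K * |w| := fun w => by
    have := hg.dist_le_mul w 0
    rw [Real.dist_eq, Real.dist_eq, sub_zero] at this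
    have := abs_sub_abs_le_abs_sub (g w) (g 0)
    linarith
  have pw : ∀ w : ℝ, 1 ≤ (1 + |w|) ^ 2 := fun w => one_le_pow₀ (by linarith [abs_nonneg w])
  have pw' : ∀ w : ℝ, 1 + |w| ≤ (1 + |w|) ^ 4 := fun w =>
    le_self_pow₀ (by linarith [abs_nonneg w]) (by norm_num)
  have hgc := hg.continuous
  have i1 : Integrable g laplaceMeasure := by
    refine lap_integrable_of_bound _ (by fun_prop) (|g 0| + K) 1 (by positivity) zero_le_one
      fun w => (bd w).trans ?_
    calc _ ≤ (|g 0| + K) * (1 + |w|) := by nlinarith [abs_nonneg w, abs_nonneg (g 0)]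
      _ ≤ _ := by gcongr; exact pw' w
  set k : ℝ → ℝ := fun w => g w - g 0 with hk
  have hkl : LipschitzWith K k := by
    refine LipschitzWith.of_dist_le_mul fun x y => ?_
    simpa [hk, Real.dist_eq] using hg.dist_le_mul x y
  have hkc := hkl.continuous
  have hkd : deriv k = deriv g := by ext w; simp [hk]
  have bk : ∀ w, |k w| ≤ K * |w| := fun w => by
    have := hg.dist_le_mul w 0
    rwa [Real.dist_eq, Real.dist_eq, sub_zero] at this
  have i2 : Integrable (fun w => k w ^ 2) laplaceMeasure := by
    refine lap_integrable_of_bound _ (by fun_prop) (K ^ 2) 1 (by positivity) zero_le_one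
      fun w => ?_
    rw [abs_pow]
    calc _ ≤ (K * |w|) ^ 2 := by gcongr; exact bk w
      _ ≤ (K * (1 + |w|) ^ 2) ^ 2 := by
        gcongr
        nlinarith [abs_nonneg w]
      _ = _ := by ring
  have i3 : Integrable (fun w => deriv g w ^ 2) laplaceMeasure := by
    refine lap_integrable_of_bound _ (by have := measurable_deriv g; fun_prop) (K ^ 2) 1
      (by positivity) zero_le_one fun w => ?_
    rw [abs_pow]
    have : |deriv g w| ≤ K := by simpa using norm_deriv_le_of_lipschitz hg (x₀ := w)
    calc _ ≤ (K:ℝ) ^ 2 * 1 := by rw [mul_one]; gcongr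
      _ ≤ _ := by gcongr; exact one_le_pow₀ (by linarith [abs_nonneg w])
  have e1 : ∫ w, g w ^ 2 ∂laplaceMeasure - (∫ w, g w ∂laplaceMeasure) ^ 2
      ≤ ∫ w, k w ^ 2 ∂laplaceMeasure := by
    have : ∫ w, g w ^ 2 ∂laplaceMeasure
        = ∫ w, (k w ^ 2 + (2 * g 0 * g w - g 0 ^ 2)) ∂laplaceMeasure := by
      congr 1; ext w; simp only [hk]; ring
    rw [this, integral_add i2 (by fun_prop), integral_sub (by fun_prop) (by fun_prop),
      integral_const_mul]
    simp
    nlinarith [sq_nonneg (∫ w, g w ∂laplaceMeasure - g 0)]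
  refine e1.trans ?_
  have n2 : Integrable (fun w => k (-w) ^ 2) laplaceMeasure := i2.comp_neg
  have n3 : Integrable (fun w => deriv g (-w) ^ 2) laplaceMeasure := i3.comp_neg
  rw [lap_half _ i2, lap_half _ i3]
  have p1 := half_poincare k K hkl (by simp [hk]) (lap_half_integrable _ i2)
    (by rw [hkd]; exact lap_half_integrable _ i3)
  have dn : ∀ w, deriv (fun w => k (-w)) w = - deriv g (-w) := fun w => by
    rw [deriv_comp_neg, hkd]
  have hkn : LipschitzWith K (fun w => k (-w)) := by
    refine LipschitzWith.of_dist_le_mul fun x y => ?_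
    simpa using hkl.dist_le_mul (-x) (-y)
  have p2 := half_poincare (fun w => k (-w)) K hkn (by simp [hk]) (lap_half_integrable _ n2)
    (by simp only [dn, neg_sq]; exact lap_half_integrable _ n3)
  simp only [dn, neg_sq] at p2
  rw [hkd] at p1
  linarith

/-- product Laplace law -/
noncomputable abbrev lapPi (d : ℕ) : Measure (Fin d → ℝ) := Measure.pi fun _ : Fin d => laplaceMeasure

lemma lapPi_succ (d : ℕ) : MeasurePreserving
    (fun z : ℝ × (Fin d → ℝ) => (Fin.cons z.1 z.2 : Fin (d+1) → ℝ))
    (laplaceMeasure.prod (lapPi d)) (lapPi (d+1)) := by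
  have := (measurePreserving_piFinSuccAbove (fun _ : Fin (d+1) => laplaceMeasure) 0).symm
  convert this using 1
  ext z i
  simp [MeasurableEquiv.piFinSuccAbove]

lemma lapPi_emb (d : ℕ) : MeasurableEmbedding
    (fun z : ℝ × (Fin d → ℝ) => (Fin.cons z.1 z.2 : Fin (d+1) → ℝ)) := by
  have := (MeasurableEquiv.piFinSuccAbove (fun _ : Fin (d+1) => ℝ) 0).symm.measurableEmbedding
  convert this using 1
  ext z i
  simp [MeasurableEquiv.piFinSuccAbove]

lemma lapPi_int_succ {d : ℕ} (F : (Fin (d+1) → ℝ) → ℝ) :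
    ∫ w, F w ∂lapPi (d+1) = ∫ z, F (Fin.cons z.1 z.2) ∂(laplaceMeasure.prod (lapPi d)) :=
  ((lapPi_succ d).integral_comp (lapPi_emb d) F).symm

lemma lapPi_integrable_succ {d : ℕ} {F : (Fin (d+1) → ℝ) → ℝ} (hF : Integrable F (lapPi (d+1))) :
    Integrable (fun z : ℝ × (Fin d → ℝ) => F (Fin.cons z.1 z.2)) (laplaceMeasure.prod (lapPi d)) :=
  ((lapPi_succ d).integrable_comp_emb (lapPi_emb d)).2 hF

lemma lapPi_ac (d : ℕ) : lapPi d ≪ volume := by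
  induction d with
  | zero =>
    have : (volume : Measure (Fin 0 → ℝ)) = lapPi 0 := by
      rw [volume_pi, Measure.pi_of_empty, lapPi, Measure.pi_of_empty]
    rw [this]
  | succ d ih =>
    rw [← (lapPi_succ d).map_eq]
    have h := (volume_preserving_piFinSuccAbove (fun _ : Fin (d+1) => ℝ) 0).symm
    have e : (fun z : ℝ × (Fin d → ℝ) => (Fin.cons z.1 z.2 : Fin (d+1) → ℝ))
      = (MeasurableEquiv.piFinSuccAbove (fun _ : Fin (d+1) => ℝ) 0).symm := by
      ext z i
      simp [MeasurableEquiv.piFinSuccAbove]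
    rw [← h.map_eq, e]
    exact (lap_ac.prod ih).map (MeasurableEquiv.measurable _)

lemma lapPi_integrable_of_bound {d : ℕ} {F : (Fin d → ℝ) → ℝ}
    (hF : AEStronglyMeasurable F (lapPi d)) (C D : ℝ)
    (hC : 0 ≤ C) (hD : 0 ≤ D) (hb : ∀ w, |F w| ≤ C * (D + ∑ i, |w i|) ^ 4) :
    Integrable F (lapPi d) := by
  have h : Integrable (fun w : Fin d → ℝ => ∏ i, Real.exp (|w i| / 2)) (lapPi d) :=
    Integrable.fintype_prod (f := fun _ w => Real.exp (|w| / 2)) fun _ => lap_integrable_exp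
  refine (h.const_mul (C * (384 * Real.exp (D / 2)))).mono' hF
    (Filter.Eventually.of_forall fun w => (hb w).trans ?_)
  have := poly_le_exp (r := D + ∑ i, |w i|) (by positivity)
  rw [add_div, Real.exp_add, Finset.sum_div, Real.exp_sum] at this
  calc _ ≤ _ := mul_le_mul_of_nonneg_left this hC
    _ = _ := by ring

/-- partial derivative -/
noncomputable def pd {d : ℕ} (F : (Fin d → ℝ) → ℝ) (i : Fin d) (w : Fin d → ℝ) : ℝ :=
  deriv (fun t => F (Function.update w i t)) (w i)

lemma lip_update {d : ℕ} {F : (Fin d → ℝ) → ℝ} {K : NNReal} (hF : LipschitzWith K F) (i : Fin d)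
    (w : Fin d → ℝ) : LipschitzWith K (fun t => F (Function.update w i t)) := by
  have : LipschitzWith 1 (fun t : ℝ => Function.update w i t) := by
    refine LipschitzWith.of_dist_le_mul fun x y => ?_
    rw [dist_pi_le_iff (by positivity)]
    intro j
    by_cases h : j = i
    · subst h; simp
    · simp [h]
  have h := hF.comp this
  rw [mul_one] at h
  exact h

lemma pd_bound {d : ℕ} {F : (Fin d → ℝ) → ℝ} {K : NNReal} (hF : LipschitzWith K F) (i : Fin d)
    (w : Fin d → ℝ) : |pd F i w| ≤ K := by
  simpa [pd] using norm_deriv_le_of_lipschitz (lip_update hF i w) (x₀ := w i)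

lemma pd_meas {d : ℕ} {F : (Fin d → ℝ) → ℝ} (hF : Continuous F) (i : Fin d) :
    Measurable (pd F i) := by
  have h : Continuous (Function.uncurry (fun (w : Fin d → ℝ) t => F (Function.update w i t))) :=
    hF.comp (continuous_fst.update i continuous_snd)
  exact (measurable_deriv_with_param h).comp (measurable_id.prodMk (measurable_pi_apply i))

lemma pd_int {d : ℕ} {F : (Fin d → ℝ) → ℝ} {K : NNReal} (hF : LipschitzWith K F) (i : Fin d) :
    Integrable (fun w => pd F i w ^ 2) (lapPi d) := by
  refine lapPi_integrable_of_bound ((pd_meas hF.continuous i).pow_const 2).aestronglyMeasurable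
    (K^2) 1 (by positivity) (by positivity) fun w => ?_
  rw [abs_pow]
  have := pd_bound hF i w
  calc _ ≤ (K:ℝ) ^ 2 * 1 := by rw [mul_one]; gcongr
    _ ≤ _ := by
      gcongr; exact one_le_pow₀ (by linarith [Finset.sum_nonneg (fun i (_ : i ∈ Finset.univ) => abs_nonneg (w i))])

lemma norm_le_sum {d : ℕ} (w : Fin d → ℝ) : ‖w‖ ≤ ∑ i, |w i| := by
  rw [pi_norm_le_iff_of_nonneg (by positivity)]
  intro i
  exact Finset.single_le_sum (f := fun i => |w i|) (fun i _ => abs_nonneg _) (Finset.mem_univ i)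

lemma lip_bound {d : ℕ} {F : (Fin d → ℝ) → ℝ} {K : NNReal} (hF : LipschitzWith K F)
    (w : Fin d → ℝ) : |F w| ≤ (|F 0| + K) * (1 + ∑ i, |w i|) := by
  have h1 := hF.dist_le_mul w 0
  rw [Real.dist_eq, dist_zero_right] at h1
  have h2 := abs_sub_abs_le_abs_sub (F w) (F 0)
  have h3 := norm_le_sum w
  have h4 : (K:ℝ) * ‖w‖ ≤ K * ∑ i, |w i| := by gcongr
  have h5 : 0 ≤ ∑ i, |w i| := by positivity
  nlinarith [K.2, abs_nonneg (F 0), show (0:ℝ) ≤ K from K.2]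

lemma lip_int {d : ℕ} {F : (Fin d → ℝ) → ℝ} {K : NNReal} (hF : LipschitzWith K F) :
    Integrable F (lapPi d) := by
  have := hF.continuous
  refine lapPi_integrable_of_bound (by fun_prop) (|F 0| + K) 1 (by positivity) (by positivity)
    fun w => (lip_bound hF w).trans ?_
  gcongr
  exact le_self_pow₀ (by linarith [Finset.sum_nonneg (fun i (_ : i ∈ Finset.univ) => abs_nonneg (w i))]) (by norm_num)

lemma lip_int2 {d : ℕ} {F : (Fin d → ℝ) → ℝ} {K : NNReal} (hF : LipschitzWith K F) :
    Integrable (fun w => F w ^ 2) (lapPi d) := by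
  have := hF.continuous
  refine lapPi_integrable_of_bound (by fun_prop) ((|F 0| + K) ^ 2) 1 (by positivity) (by positivity)
    fun w => ?_
  have h5 : 0 ≤ ∑ i, |w i| := by positivity
  rw [abs_pow]
  calc _ ≤ ((|F 0| + K) * (1 + ∑ i, |w i|)) ^ 2 := by gcongr; exact lip_bound hF w
    _ = (|F 0| + K) ^ 2 * (1 + ∑ i, |w i|) ^ 2 := by ring
    _ ≤ _ := by gcongr 1; exact pow_le_pow_right₀ (by linarith) (by norm_num)

lemma lip_cons {d : ℕ} {F : (Fin (d+1) → ℝ) → ℝ} {K : NNReal} (hF : LipschitzWith K F) :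
    LipschitzWith K (fun z : ℝ × (Fin d → ℝ) => F (Fin.cons z.1 z.2)) := by
  have : LipschitzWith 1 (fun z : ℝ × (Fin d → ℝ) => (Fin.cons z.1 z.2 : Fin (d+1) → ℝ)) := by
    refine LipschitzWith.of_dist_le_mul fun x y => ?_
    rw [dist_pi_le_iff (by positivity)]
    intro j
    simp only [NNReal.coe_one, one_mul]
    refine Fin.cases ?_ (fun j => ?_) j
    · rw [Prod.dist_eq]; exact le_max_left _ _
    · rw [Prod.dist_eq]; exact (dist_le_pi_dist x.2 y.2 j).trans (le_max_right _ _)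
  have h := hF.comp this
  rw [mul_one] at h
  exact h


lemma lin_expand {Ω : Type*} [MeasurableSpace Ω] (μ : Measure Ω) [IsProbabilityMeasure μ]
    (F M N : Ω → ℝ) (m : ℝ) (iF : Integrable F μ) (iM : Integrable M μ) (iN : Integrable N μ)
    (iFF : Integrable (fun z => F z ^ 2) μ) (iMM : Integrable (fun z => M z ^ 2) μ)
    (iNN : Integrable (fun z => N z ^ 2) μ) (iFM : Integrable (fun z => F z * M z) μ)
    (iFN : Integrable (fun z => F z * N z) μ) (iMN : Integrable (fun z => N z * M z) μ) :
    ∫ z, (F z - M z - N z + m) ^ 2 ∂μ = ∫ z, F z ^ 2 ∂μ + ∫ z, M z ^ 2 ∂μ + ∫ z, N z ^ 2 ∂μ + m ^ 2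
      - 2 * ∫ z, F z * M z ∂μ - 2 * ∫ z, F z * N z ∂μ + 2 * m * ∫ z, F z ∂μ
      + 2 * ∫ z, N z * M z ∂μ - 2 * m * ∫ z, M z ∂μ - 2 * m * ∫ z, N z ∂μ := by
  have ic : Integrable (fun _ : Ω => m ^ 2) μ := integrable_const _
  have j1 := iFM.const_mul (-2)
  have j2 := iFN.const_mul (-2)
  have j3 := iF.const_mul (2 * m)
  have j4 := iMN.const_mul 2
  have j5 := iM.const_mul (-2 * m)
  have j6 := iN.const_mul (-2 * m)
  have k5 := j5.add j6
  have k4 := j4.add k5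
  have k3 := j3.add k4
  have k2 := j2.add k3
  have k1 := j1.add k2
  have k0 := ic.add k1
  have kN := iNN.add k0
  have kM := iMM.add kN
  have ex : ∫ z, (F z - M z - N z + m) ^ 2 ∂μ
      = ∫ z, (F z ^ 2 + (M z ^ 2 + (N z ^ 2 + (m ^ 2 + ((-2) * (F z * M z)
        + ((-2) * (F z * N z) + ((2 * m) * F z + (2 * (N z * M z) + ((-2 * m) * M z
        + (-2 * m) * N z))))))))) ∂μ := by
    congr 1; ext z; ring
  rw [ex]
  erw [integral_add iFF kM, integral_add iMM kN, integral_add iNN k0, integral_add ic k1,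
    integral_add j1 k2, integral_add j2 k3, integral_add j3 k4, integral_add j4 k5,
    integral_add j5 j6]
  simp only [integral_const_mul]
  simp
  ring

/-- tensorization of variance. -/
lemma var_tensor {α β : Type*} [MeasurableSpace α] [MeasurableSpace β] (μ : Measure α)
    (ν : Measure β) [IsProbabilityMeasure μ] [IsProbabilityMeasure ν] (F : α × β → ℝ)
    (M : β → ℝ) (N : α → ℝ) (hMe : ∀ y, M y = ∫ x, F (x, y) ∂μ) (hNe : ∀ x, N x = ∫ y, F (x, y) ∂ν)
    (hF : MemLp F 2 (μ.prod ν)) (hM : MemLp M 2 ν) (hN : MemLp N 2 μ) :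
    ∫ y, M y ^ 2 ∂ν + ∫ x, N x ^ 2 ∂μ ≤ 
    ∫ z, F z ^ 2 ∂(μ.prod ν) + (∫ z, F z ∂(μ.prod ν)) ^ 2 := by
  have hM' : MemLp (fun z : α × β => M z.2) 2 (μ.prod ν) :=
    hM.comp_measurePreserving (measurePreserving_snd (μ := μ) (ν := ν))
  have hN' : MemLp (fun z : α × β => N z.1) 2 (μ.prod ν) :=
    hN.comp_measurePreserving (measurePreserving_fst (μ := μ) (ν := ν))
  have iF := hF.integrable (by norm_num)
  have iM := hM'.integrable (by norm_num)
  have iN := hN'.integrable (by norm_num)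
  have iFF := hF.integrable_sq
  have iMM := hM'.integrable_sq
  have iNN := hN'.integrable_sq
  have iFM : Integrable (fun z => F z * M z.2) (μ.prod ν) := hF.integrable_mul hM'
  have iFN : Integrable (fun z => F z * N z.1) (μ.prod ν) := hF.integrable_mul hN'
  have iMN : Integrable (fun z : α × β => N z.1 * M z.2) (μ.prod ν) := hN'.integrable_mul hM'
  set m := ∫ z, F z ∂(μ.prod ν) with hm
  have eM : ∫ y, M y ∂ν = m := by
    rw [hm, integral_prod_symm _ iF]; simp only [hMe]
  have eN : ∫ x, N x ∂μ = m := by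
    rw [hm, integral_prod _ iF]; simp only [hNe]
  have eM1 : ∫ z : α × β, M z.2 ∂(μ.prod ν) = m := by
    rw [← eM, integral_prod_symm _ iM]; simp
  have eN1 : ∫ z : α × β, N z.1 ∂(μ.prod ν) = m := by
    rw [← eN, integral_prod _ iN]; simp
  have eM2 : ∫ z : α × β, M z.2 ^ 2 ∂(μ.prod ν) = ∫ y, M y ^ 2 ∂ν := by
    rw [integral_prod_symm _ iMM]; simp
  have eN2 : ∫ z : α × β, N z.1 ^ 2 ∂(μ.prod ν) = ∫ x, N x ^ 2 ∂μ := by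
    rw [integral_prod _ iNN]; simp
  have eMN : ∫ z : α × β, N z.1 * M z.2 ∂(μ.prod ν) = m * m := by
    rw [integral_prod_mul, eM, eN]
  have eFM : ∫ z : α × β, F z * M z.2 ∂(μ.prod ν) = ∫ y, M y ^ 2 ∂ν := by
    rw [integral_prod_symm _ iFM]
    congr 1; ext y
    simp only
    rw [integral_mul_const, ← hMe]; ring
  have eFN : ∫ z : α × β, F z * N z.1 ∂(μ.prod ν) = ∫ x, N x ^ 2 ∂μ := by
    rw [integral_prod _ iFN]
    congr 1; ext y
    simp only
    rw [integral_mul_const, ← hNe]; ring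
  have pos : 0 ≤ ∫ z : α × β, (F z - M z.2 - N z.1 + m) ^ 2 ∂(μ.prod ν) :=
    integral_nonneg fun z => sq_nonneg _
  rw [lin_expand (μ.prod ν) F (fun z => M z.2) (fun z => N z.1) m iF iM iN iFF iMM iNN iFM iFN iMN] at pos
  simp only [integral_const_mul, eM1, eN1, eM2, eN2, eMN, eFM, eFN, ← hm] at pos
  nlinarith

lemma lip_integral_param {α β : Type*} [MeasurableSpace α] [PseudoMetricSpace β] (μ : Measure α)
    [IsProbabilityMeasure μ] (F : α → β → ℝ) (K : NNReal) (hF : ∀ x, LipschitzWith K (F x))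
    (hi : ∀ y, Integrable (fun x => F x y) μ) : LipschitzWith K (fun y => ∫ x, F x y ∂μ) := by
  refine LipschitzWith.of_dist_le_mul fun y y' => ?_
  rw [Real.dist_eq, ← integral_sub (hi y) (hi y')]
  have := norm_integral_le_of_norm_le_const (μ := μ) (f := fun x => F x y - F x y')
    (C := K * dist y y') (Filter.Eventually.of_forall fun x => by
      simpa [Real.dist_eq] using (hF x).dist_le_mul y y')
  simpa using this

lemma lip1_int {g : ℝ → ℝ} {K : NNReal} (hg : LipschitzWith K g) :
    Integrable g laplaceMeasure ∧ Integrable (fun t => g t ^ 2) laplaceMeasure := by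
  have hc := hg.continuous
  have hK : (0:ℝ) ≤ K := K.2
  have bd : ∀ w, |g w| ≤ (|g 0| + K) * (1 + |w|) := fun w => by
    have := hg.dist_le_mul w 0
    rw [Real.dist_eq, Real.dist_eq, sub_zero] at this
    have := abs_sub_abs_le_abs_sub (g w) (g 0)
    nlinarith [abs_nonneg w, abs_nonneg (g 0)]
  constructor
  · refine lap_integrable_of_bound _ (by fun_prop) (|g 0| + K) 1 (by positivity) zero_le_one
      fun w => (bd w).trans ?_
    gcongr
    exact le_self_pow₀ (by linarith [abs_nonneg w]) (by norm_num)
  · refine lap_integrable_of_bound _ (by fun_prop) ((|g 0| + K) ^ 2) 1 (by positivity) zero_le_one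
      fun w => ?_
    rw [abs_pow]
    calc _ ≤ ((|g 0| + K) * (1 + |w|)) ^ 2 := by gcongr; exact bd w
      _ = (|g 0| + K) ^ 2 * (1 + |w|) ^ 2 := by ring
      _ ≤ _ := by gcongr 1; exact pow_le_pow_right₀ (by linarith [abs_nonneg w]) (by norm_num)

lemma lapPi_poincare (d : ℕ) : ∀ (F : (Fin d → ℝ) → ℝ) (K : NNReal), LipschitzWith K F →
    ∫ w, F w ^ 2 ∂lapPi d - (∫ w, F w ∂lapPi d) ^ 2
      ≤ 4 * ∑ i, ∫ w, pd F i w ^ 2 ∂lapPi d := by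
  induction d with
  | zero =>
    intro F K hF
    have : ∀ w, F w = F 0 := fun w => by rw [Subsingleton.elim w 0]
    simp [this]
  | succ d ih =>
    intro F K hF
    set H : ℝ × (Fin d → ℝ) → ℝ := fun z => F (Fin.cons z.1 z.2) with hH
    have hl : LipschitzWith K H := lip_cons hF
    have hl1 : ∀ y, LipschitzWith K (fun x => H (x, y)) := fun y => by
      have := hl.comp (LipschitzWith.prodMk_right y)
      rwa [mul_one] at this
    have hl2 : ∀ x, LipschitzWith K (fun y => H (x, y)) := fun x => by
      have := hl.comp (LipschitzWith.prodMk_left x)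
      rwa [mul_one] at this
    have i1 : Integrable H (laplaceMeasure.prod (lapPi d)) := lapPi_integrable_succ (lip_int hF)
    have i2 : Integrable (fun z => H z ^ 2) (laplaceMeasure.prod (lapPi d)) :=
      lapPi_integrable_succ (lip_int2 hF)
    have hHL : MemLp H 2 (laplaceMeasure.prod (lapPi d)) :=
      (memLp_two_iff_integrable_sq i1.aestronglyMeasurable).2 i2
    set M : (Fin d → ℝ) → ℝ := fun y => ∫ x, H (x, y) ∂laplaceMeasure
    set N : ℝ → ℝ := fun x => ∫ y, H (x, y) ∂lapPi d
    have lM : LipschitzWith K M := lip_integral_param laplaceMeasure (fun x y => H (x, y)) K hl2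
      fun y => (lip1_int (hl1 y)).1
    have lN : LipschitzWith K N := lip_integral_param (lapPi d) (fun y x => H (x, y)) K hl1
      fun x => lip_int (hl2 x)
    have hML : MemLp M 2 (lapPi d) :=
      (memLp_two_iff_integrable_sq (lip_int lM).aestronglyMeasurable).2 (lip_int2 lM)
    have hNL : MemLp N 2 laplaceMeasure :=
      (memLp_two_iff_integrable_sq (lip1_int lN).1.aestronglyMeasurable).2 (lip1_int lN).2
    have T := var_tensor laplaceMeasure (lapPi d) H M N (fun _ => rfl) (fun _ => rfl) hHL hML hNL
    rw [lapPi_int_succ, lapPi_int_succ, Fin.sum_univ_succ, lapPi_int_succ]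
    change ∫ z, H z ^ 2 ∂_ - (∫ z, H z ∂_) ^ 2 ≤ _
    have p0 : ∀ z : ℝ × (Fin d → ℝ), pd F 0 (Fin.cons z.1 z.2) = deriv (fun t => H (t, z.2)) z.1 := by
      intro z; simp [pd, hH, Fin.update_cons_zero]
    have pS : ∀ (i : Fin d) (z : ℝ × (Fin d → ℝ)), pd F i.succ (Fin.cons z.1 z.2)
        = pd (fun y => H (z.1, y)) i z.2 := by
      intro i z; simp [pd, hH, Fin.cons_update]
    have d0 : Integrable (fun z : ℝ × (Fin d → ℝ) => deriv (fun t => H (t, z.2)) z.1 ^ 2)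
        (laplaceMeasure.prod (lapPi d)) := by
      have := lapPi_integrable_succ (pd_int hF 0)
      simpa only [p0] using this
    have dS : ∀ i, Integrable (fun z : ℝ × (Fin d → ℝ) => pd (fun y => H (z.1, y)) i z.2 ^ 2)
        (laplaceMeasure.prod (lapPi d)) := fun i => by
      have := lapPi_integrable_succ (pd_int hF i.succ)
      simpa only [pS] using this
    have s1 : ∫ z, H z ^ 2 ∂(laplaceMeasure.prod (lapPi d)) - ∫ y, M y ^ 2 ∂lapPi d
        ≤ 4 * ∫ z : ℝ × (Fin d → ℝ), pd F 0 (Fin.cons z.1 z.2) ^ 2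
          ∂(laplaceMeasure.prod (lapPi d)) := by
      simp only [p0]
      rw [integral_prod_symm _ i2, integral_prod_symm _ d0, ← integral_sub i2.integral_prod_right
        (lip_int2 lM), ← integral_const_mul]
      refine integral_mono (i2.integral_prod_right.sub (lip_int2 lM))
        (d0.integral_prod_right.const_mul 4) fun y => ?_
      exact lap_poincare _ K (hl1 y)
    have s2 : ∫ z, H z ^ 2 ∂(laplaceMeasure.prod (lapPi d)) - ∫ x, N x ^ 2 ∂laplaceMeasure
        ≤ 4 * ∑ i : Fin d, ∫ w, pd F i.succ w ^ 2 ∂lapPi (d+1) := by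
      have : ∀ i : Fin d, ∫ w, pd F i.succ w ^ 2 ∂lapPi (d+1)
          = ∫ x, ∫ y, pd (fun y => H (x, y)) i y ^ 2 ∂lapPi d ∂laplaceMeasure := fun i => by
        rw [lapPi_int_succ]
        simp only [pS]
        rw [integral_prod _ (dS i)]
      simp only [this]
      rw [integral_prod _ i2, ← integral_sub i2.integral_prod_left (lip1_int lN).2,
        ← integral_finsetSum _ (fun i _ => (dS i).integral_prod_left), ← integral_const_mul]
      refine integral_mono (i2.integral_prod_left.sub (lip1_int lN).2)
        ((integrable_finsetSum _ (fun i _ => (dS i).integral_prod_left)).const_mul 4) fun x => ?_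
      exact ih _ K (hl2 x)
    linarith

/-- Poincare for ℓ²-Lipschitz functions. -/
lemma lapPi_var (d : ℕ) (F : (Fin d → ℝ) → ℝ) (K : ℝ) (hK : 0 ≤ K)
    (hF : ∀ x y, |F x - F y| ≤ K * Real.sqrt (∑ i, (x i - y i) ^ 2)) :
    ∃ C : NNReal, LipschitzWith C F ∧
    ∫ w, F w ^ 2 ∂lapPi d - (∫ w, F w ∂lapPi d) ^ 2 ≤ 4 * K ^ 2 := by
  have hl : LipschitzWith ⟨K * Real.sqrt d, by positivity⟩ F := by
    refine LipschitzWith.of_dist_le_mul fun x y => ?_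
    rw [Real.dist_eq]
    refine (hF x y).trans ?_
    change _ ≤ (K * Real.sqrt d) * _
    rw [mul_assoc]
    gcongr
    rw [← Real.sqrt_sq (dist_nonneg (x := x) (y := y)), ← Real.sqrt_mul (by positivity)]
    apply Real.sqrt_le_sqrt
    calc ∑ i, (x i - y i) ^ 2 ≤ ∑ i : Fin d, dist x y ^ 2 := by
          refine Finset.sum_le_sum fun i _ => ?_
          rw [← sq_abs, ← Real.dist_eq]
          gcongr
          exact dist_le_pi_dist x y i
      _ = _ := by simp
  refine ⟨_, hl, (lapPi_poincare d F _ hl).trans ?_⟩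
  gcongr
  rw [← integral_finsetSum _ fun i _ => pd_int hl i]
  have : ∫ w, K ^ 2 ∂lapPi d = K ^ 2 := by simp
  rw [← this]
  refine integral_mono_ae (integrable_finsetSum _ fun i _ => pd_int hl i) (by fun_prop) ?_
  filter_upwards [(lapPi_ac d).ae_le hl.ae_differentiableAt] with w hw
  have hpd : ∀ i, pd F i w = fderiv ℝ F w (Pi.single i 1) := fun i => by
    have h1 : HasDerivAt (fun t => Function.update w i t) (Pi.single i (1:ℝ)) (w i) :=
      hasDerivAt_update w i (w i)
    have hw' : HasFDerivAt F (fderiv ℝ F w) (Function.update w i (w i)) := by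
      simpa using hw.hasFDerivAt
    exact (hw'.comp_hasDerivAt (w i) h1).deriv
  set v : Fin d → ℝ := fun i => pd F i w with hv
  have hlin : fderiv ℝ F w v = ∑ i, v i ^ 2 := by
    have : v = ∑ i, v i • (Pi.single i (1:ℝ) : Fin d → ℝ) := by
      ext j; simp [Finset.sum_apply, Pi.single_apply]
    conv_lhs => rw [this]
    rw [map_sum]
    refine Finset.sum_congr rfl fun i _ => ?_
    rw [map_smul, ← hpd, smul_eq_mul, sq]
  have hline : HasDerivAt (fun t : ℝ => F (w + t • v)) (fderiv ℝ F w v) 0 := by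
    have h1 : HasDerivAt (fun t : ℝ => w + t • v) v 0 := by
      simpa using ((hasDerivAt_id (0:ℝ)).smul_const v).const_add w
    have hw' : HasFDerivAt F (fderiv ℝ F w) (w + (0:ℝ) • v) := by simpa using hw.hasFDerivAt
    exact hw'.comp_hasDerivAt (0:ℝ) h1
  have hL2 : LipschitzWith ⟨K * Real.sqrt (∑ i, v i ^ 2), by positivity⟩
      (fun t : ℝ => F (w + t • v)) := by
    refine LipschitzWith.of_dist_le_mul fun s t => ?_
    rw [Real.dist_eq, Real.dist_eq]
    refine (hF _ _).trans (le_of_eq ?_)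
    change _ = (K * Real.sqrt (∑ i, v i ^ 2)) * _
    rw [mul_assoc]
    congr 1
    rw [← Real.sqrt_sq (abs_nonneg (s - t)), ← Real.sqrt_mul (by positivity), sq_abs, Finset.sum_mul]
    congr 1
    refine Finset.sum_congr rfl fun i _ => ?_
    simp; ring
  have hb := norm_deriv_le_of_lipschitz hL2 (x₀ := 0)
  rw [hline.deriv, hlin, Real.norm_of_nonneg (by positivity)] at hb
  change _ ≤ K * Real.sqrt (∑ i, v i ^ 2) at hb
  set s := ∑ i, v i ^ 2 with hs
  have hs0 : 0 ≤ s := by positivity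
  change s ≤ K ^ 2
  have h3 := Real.sq_sqrt hs0
  have h4 := Real.sqrt_nonneg s
  by_contra hcon
  push Not at hcon
  have : K < Real.sqrt s := Real.lt_sqrt_of_sq_lt hcon
  nlinarith

lemma lap_poly (φ : ℝ → ℝ) (a b c d e : ℝ)
    (h : ∀ t, φ t = a * |t| ^ 0 + (b * |t| ^ 1 + (c * |t| ^ 2 + (d * |t| ^ 3 + e * |t| ^ 4)))) :
    Integrable φ laplaceMeasure ∧ ∫ t, φ t ∂laplaceMeasure = a + b + 2 * c + 6 * d + 24 * e := by
  have i0 := (lap_integrable_pow 0 (by norm_num)).const_mul a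
  have i1 := (lap_integrable_pow 1 (by norm_num)).const_mul b
  have i2 := (lap_integrable_pow 2 (by norm_num)).const_mul c
  have i3 := (lap_integrable_pow 3 (by norm_num)).const_mul d
  have i4 := (lap_integrable_pow 4 (by norm_num)).const_mul e
  have e : φ = _ := funext h
  rw [e]
  refine ⟨i0.add (i1.add (i2.add (i3.add i4))), ?_⟩
  erw [integral_add i0 (i1.add (i2.add (i3.add i4))), integral_add i1 (i2.add (i3.add i4)),
    integral_add i2 (i3.add i4), integral_add i3 i4]
  simp only [integral_const_mul]
  rw [lap_moment 0 (by norm_num), lap_moment 1 (by norm_num), lap_moment 2 (by norm_num),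
    lap_moment 3 (by norm_num), lap_moment 4 (by norm_num)]
  norm_num [Nat.factorial]
  ring

noncomputable def Sf {d : ℕ} (w : Fin d → ℝ) : ℝ := ∑ i, (|w i| - 1)
noncomputable def Qf {d : ℕ} (w : Fin d → ℝ) : ℝ := ∑ i, w i ^ 2

lemma Sf_cont {d : ℕ} : Continuous (Sf (d := d)) := by unfold Sf; fun_prop
lemma Qf_cont {d : ℕ} : Continuous (Qf (d := d)) := by unfold Qf; fun_prop

lemma Qf_le {d : ℕ} (w : Fin d → ℝ) : Qf w ≤ (∑ i, |w i|) ^ 2 := by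
  unfold Qf
  simp_rw [← sq_abs (w _)]
  exact Finset.sum_sq_le_sq_sum_of_nonneg fun i _ => abs_nonneg _

lemma Qf_nonneg {d : ℕ} (w : Fin d → ℝ) : 0 ≤ Qf w := by unfold Qf; positivity

lemma Sf_eq {d : ℕ} (w : Fin d → ℝ) : Sf w = ∑ i, |w i| - d := by simp [Sf]

lemma Sf_le {d : ℕ} (w : Fin d → ℝ) : |Sf w| ≤ 1 + d + ∑ i, |w i| := by
  have : 0 ≤ ∑ i, |w i| := by positivity
  have : (0:ℝ) ≤ d := by positivity
  rw [Sf_eq, abs_le]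
  constructor <;> linarith

lemma QS_int {d : ℕ} (a b : ℕ) (h : 2 * a + b ≤ 4) :
    Integrable (fun w : Fin d → ℝ => Qf w ^ a * Sf w ^ b) (lapPi d) := by
  have h1 := Sf_cont (d := d)
  have h2 := Qf_cont (d := d)
  refine lapPi_integrable_of_bound (by fun_prop) 1 (1 + d) (by positivity) (by positivity)
    fun w => ?_
  have h0 : 0 ≤ ∑ i, |w i| := by positivity
  have hd : (0:ℝ) ≤ d := by positivity
  rw [abs_mul, abs_pow, abs_pow, abs_of_nonneg (Qf_nonneg w), one_mul]
  calc Qf w ^ a * |Sf w| ^ b ≤ ((1 + d + ∑ i, |w i|) ^ 2) ^ a * (1 + d + ∑ i, |w i|) ^ b := by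
        gcongr
        · exact Qf_nonneg w
        · refine (Qf_le w).trans ?_
          gcongr; linarith
        · exact Sf_le w
    _ = (1 + d + ∑ i, |w i|) ^ (2 * a + b) := by rw [← pow_mul, ← pow_add]
    _ ≤ _ := pow_le_pow_right₀ (by linarith) h

lemma Sf_cons {d : ℕ} (t : ℝ) (w : Fin d → ℝ) :
    Sf (Fin.cons t w : Fin (d+1) → ℝ) = (|t| - 1) + Sf w := by
  simp [Sf, Fin.sum_univ_succ]
  ring
lemma Qf_cons {d : ℕ} (t : ℝ) (w : Fin d → ℝ) :
    Qf (Fin.cons t w : Fin (d+1) → ℝ) = t ^ 2 + Qf w := by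
  simp [Qf, Fin.sum_univ_succ]

lemma moments (d : ℕ) : ∫ w, Sf w ∂lapPi d = 0 ∧ ∫ w, Sf w ^ 2 ∂lapPi d = d ∧
    ∫ w, Sf w ^ 4 ∂lapPi d = 3 * d ^ 2 + 6 * d ∧ ∫ w, Qf w ∂lapPi d = 2 * d ∧
    ∫ w, Qf w * Sf w ^ 2 ∂lapPi d = 2 * d ^ 2 + 12 * d := by
  induction d with
  | zero => simp [Sf, Qf]
  | succ d ih =>
    obtain ⟨m1, m2, m4, q0, q2⟩ := ih
    have iS : Integrable (fun w : Fin d → ℝ => Sf w) (lapPi d) := by simpa using QS_int (d := d) 0 1 (by norm_num)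
    have iS2 : Integrable (fun w : Fin d → ℝ => Sf w ^ 2) (lapPi d) := by simpa using QS_int (d := d) 0 2 (by norm_num)
    have iS3 : Integrable (fun w : Fin d → ℝ => Sf w ^ 3) (lapPi d) := by simpa using QS_int (d := d) 0 3 (by norm_num)
    have iS4 : Integrable (fun w : Fin d → ℝ => Sf w ^ 4) (lapPi d) := by simpa using QS_int (d := d) 0 4 (by norm_num)
    have iQ : Integrable (fun w : Fin d → ℝ => Qf w) (lapPi d) := by simpa using QS_int (d := d) 1 0 (by norm_num)
    have iQS : Integrable (fun w : Fin d → ℝ => Qf w * Sf w) (lapPi d) := by simpa using QS_int (d := d) 1 1 (by norm_num)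
    have iQS2 : Integrable (fun w : Fin d → ℝ => Qf w * Sf w ^ 2) (lapPi d) := by simpa using QS_int (d := d) 1 2 (by norm_num)
    have i1 : Integrable (fun _ : Fin d → ℝ => (1:ℝ)) (lapPi d) := integrable_const _
    have v1 : ∫ _ : Fin d → ℝ, (1:ℝ) ∂(lapPi d) = 1 := by simp
    obtain ⟨x0, y0⟩ := lap_poly (fun _ => 1) 1 0 0 0 0 (fun t => by ring)
    obtain ⟨x1, y1⟩ := lap_poly (fun t => |t| - 1) (-1) 1 0 0 0 (fun t => by ring)
    obtain ⟨x2, y2⟩ := lap_poly (fun t => (|t| - 1) ^ 2) 1 (-2) 1 0 0 (fun t => by ring)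
    obtain ⟨x3, y3⟩ := lap_poly (fun t => (|t| - 1) ^ 3) (-1) 3 (-3) 1 0 (fun t => by ring)
    obtain ⟨x4, y4⟩ := lap_poly (fun t => (|t| - 1) ^ 4) 1 (-4) 6 (-4) 1 (fun t => by ring)
    obtain ⟨t0, u0⟩ := lap_poly (fun t => t ^ 2) 0 0 1 0 0 (fun t => by rw [← sq_abs]; ring)
    obtain ⟨t1, u1⟩ := lap_poly (fun t => t ^ 2 * (|t| - 1)) 0 0 (-1) 1 0 (fun t => by rw [← sq_abs t]; ring)
    obtain ⟨t2, u2⟩ := lap_poly (fun t => t ^ 2 * (|t| - 1) ^ 2) 0 0 1 (-2) 1 (fun t => by rw [← sq_abs t]; ring)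
    have cm : ∀ (φ : ℝ → ℝ) (ψ : (Fin d → ℝ) → ℝ), Integrable φ laplaceMeasure →
      Integrable ψ (lapPi d) → Integrable (fun z : ℝ × (Fin d → ℝ) => φ z.1 * ψ z.2)
        (laplaceMeasure.prod (lapPi d)) := fun φ ψ h1 h2 => h1.mul_prod h2
    have pm : ∀ (φ : ℝ → ℝ) (ψ : (Fin d → ℝ) → ℝ),
      ∫ z : ℝ × (Fin d → ℝ), φ z.1 * ψ z.2 ∂(laplaceMeasure.prod (lapPi d))
        = (∫ t, φ t ∂laplaceMeasure) * ∫ w, ψ w ∂(lapPi d) := fun φ ψ => integral_prod_mul φ ψ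
    rw [lapPi_int_succ, lapPi_int_succ, lapPi_int_succ, lapPi_int_succ, lapPi_int_succ]
    simp only [Sf_cons, Qf_cons]
    push_cast
    refine ⟨?_, ?_, ?_, ?_, ?_⟩
    · have a1 := cm _ _ x1 i1
      have a2 := cm _ _ x0 iS
      have e := integral_add a1 a2
      rw [pm (fun t => |t| - 1) (fun _ => 1), pm (fun _ => 1) (fun w => Sf w), y1, m1] at e
      calc _ = _ := by congr 1; ext z; ring
        _ = _ := e
        _ = _ := by rw [v1]; ring
    · have a1 := cm _ _ x2 i1
      have a2 := (cm _ _ x1 iS).const_mul 2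
      have a3 := cm _ _ x0 iS2
      have e := integral_add a1 (a2.add a3)
      have e2 := integral_add a2 a3
      simp only [Pi.add_apply] at e
      rw [e2, integral_const_mul, pm (fun t => (|t| - 1)^2) (fun _ => 1),
        pm (fun t => |t| - 1) (fun w => Sf w),
        pm (fun _ => 1) (fun w => Sf w ^ 2), y0, y1, y2, m1, m2, v1] at e
      calc _ = _ := by congr 1; ext z; ring
        _ = _ := e
        _ = _ := by ring
    · have a1 := cm _ _ x4 i1
      have a2 := (cm _ _ x3 iS).const_mul 4
      have a3 := (cm _ _ x2 iS2).const_mul 6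
      have a4 := (cm _ _ x1 iS3).const_mul 4
      have a5 := cm _ _ x0 iS4
      have e := integral_add a1 (a2.add (a3.add (a4.add a5)))
      have e2 := integral_add a2 (a3.add (a4.add a5))
      have e3 := integral_add a3 (a4.add a5)
      have e4 := integral_add a4 a5
      simp only [Pi.add_apply] at e e2 e3
      rw [e2, e3, e4, integral_const_mul, integral_const_mul, integral_const_mul,
        pm (fun t => (|t| - 1)^4) (fun _ => 1),
        pm (fun t => (|t| - 1)^3) (fun w => Sf w),
        pm (fun t => (|t| - 1)^2) (fun w => Sf w ^ 2),
        pm (fun t => (|t| - 1)) (fun w => Sf w ^ 3),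
        pm (fun _ => 1) (fun w => Sf w ^ 4), y0, y1, y2, y4, m1, m2, m4, v1] at e
      calc _ = _ := by congr 1; ext z; ring
        _ = _ := e
        _ = _ := by ring
    · have a1 := cm _ _ t0 i1
      have a2 := cm _ _ x0 iQ
      have e := integral_add a1 a2
      rw [pm (fun t => t ^ 2) (fun _ => 1), pm (fun _ => 1) (fun w => Qf w), y0, u0, q0, v1] at e
      calc _ = _ := by congr 1; ext z; ring
        _ = _ := e
        _ = _ := by ring
    · have a1 := cm _ _ t2 i1
      have a2 := (cm _ _ t1 iS).const_mul 2
      have a3 := cm _ _ t0 iS2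
      have a4 := cm _ _ x2 iQ
      have a5 := (cm _ _ x1 iQS).const_mul 2
      have a6 := cm _ _ x0 iQS2
      have e := integral_add a1 (a2.add (a3.add (a4.add (a5.add a6))))
      have e2 := integral_add a2 (a3.add (a4.add (a5.add a6)))
      have e3 := integral_add a3 (a4.add (a5.add a6))
      have e4 := integral_add a4 (a5.add a6)
      have e5 := integral_add a5 a6
      simp only [Pi.add_apply] at e e2 e3 e4
      rw [e2, e3, e4, e5, integral_const_mul, integral_const_mul,
        pm (fun t => t ^ 2 * (|t| - 1)^2) (fun _ => 1),
        pm (fun t => t ^ 2 * (|t| - 1)) (fun w => Sf w),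
        pm (fun t => t ^ 2) (fun w => Sf w ^ 2),
        pm (fun t => (|t| - 1)^2) (fun w => Qf w),
        pm (fun t => (|t| - 1)) (fun w => Qf w * Sf w),
        pm (fun _ => 1) (fun w => Qf w * Sf w ^ 2), y0, y1, y2, u0, u2, m1, m2, q0, q2, v1] at e
      calc _ = _ := by congr 1; ext z; ring
        _ = _ := e
        _ = _ := by ring

lemma ptwise {d : ℕ} (hd : 1 ≤ d) (w : Fin d → ℝ) :
    ((∑ i, |w i|)⁻¹ - (d:ℝ)⁻¹) ^ 2 * Qf w
      ≤ 4 / (d:ℝ) ^ 4 * (Qf w * Sf w ^ 2 + Sf w ^ 4) := by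
  have hS := Sf_eq w
  have hQ := Qf_le w
  have hQ0 := Qf_nonneg w
  have hR0 : 0 ≤ ∑ i, |w i| := by positivity
  set R := ∑ i, |w i| with hR
  set Q := Qf w
  set S := Sf w
  have hd0 : (0:ℝ) < d := by exact_mod_cast hd
  rcases hR0.eq_or_lt with h | h
  · have : Q = 0 := by rw [← h] at hQ; nlinarith
    rw [this]
    have : 0 ≤ S ^ 4 := by positivity
    simp only [mul_zero, zero_mul, zero_add]
    positivity
  · have e : (R⁻¹ - (d:ℝ)⁻¹) ^ 2 * Q = S ^ 2 * Q / (R ^ 2 * d ^ 2) := by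
      rw [hS]; field_simp; ring
    rw [e, div_mul_eq_mul_div, div_le_div_iff₀ (by positivity) (by positivity)]
    have s4 : 0 ≤ S ^ 4 := by positivity
    have qs : 0 ≤ Q * S ^ 2 := by positivity
    by_cases hc : (d:ℝ) ≤ 2 * R
    · have h1 : (d:ℝ) ^ 2 ≤ 4 * R ^ 2 := by nlinarith
      have : S ^ 2 * Q * d ^ 4 ≤ 4 * (Q * S ^ 2) * (R ^ 2 * d ^ 2) := by
        calc _ = (Q * S ^ 2 * d ^ 2) * d ^ 2 := by ring
          _ ≤ (Q * S ^ 2 * d ^ 2) * (4 * R ^ 2) := by gcongr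
          _ = _ := by ring
      refine this.trans ?_
      gcongr
      linarith
    · push Not at hc
      have h1 : (d:ℝ) ^ 2 ≤ 4 * S ^ 2 := by rw [hS]; nlinarith
      have : S ^ 2 * Q * d ^ 4 ≤ 4 * (S ^ 4) * (R ^ 2 * d ^ 2) := by
        calc _ ≤ S ^ 2 * R ^ 2 * d ^ 4 := by gcongr
          _ = (S ^ 2 * R ^ 2 * d ^ 2) * d ^ 2 := by ring
          _ ≤ (S ^ 2 * R ^ 2 * d ^ 2) * (4 * S ^ 2) := by gcongr
          _ = _ := by ring
      refine this.trans ?_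
      gcongr
      linarith

lemma core {d : ℕ} (hd : 1 ≤ d) (G : (Fin d → ℝ) → ℝ) (K : ℝ) (hK : 0 ≤ K)
    (hG : ∀ x y, |G x - G y| ≤ K * Real.sqrt (∑ i, (x i - y i) ^ 2))
    (hodd : ∀ x, G (-x) = - G x) :
    ∫ w, G ((∑ i, |w i|)⁻¹ • w) ^ 2 ∂lapPi d ≤ 64 * K ^ 2 / (d:ℝ) ^ 2 := by
  have hd0 : (0:ℝ) < d := by exact_mod_cast hd
  have G0 : G 0 = 0 := by have := hodd 0; rw [neg_zero] at this; linarith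
  by_cases h8 : d ≤ 8
  · have b : ∀ w : Fin d → ℝ, G ((∑ i, |w i|)⁻¹ • w) ^ 2 ≤ K ^ 2 := fun w => by
      set z := (∑ i, |w i|)⁻¹ • w with hz
      have h1 := hG z 0
      rw [G0, sub_zero] at h1
      have h2 : ∑ i, (z i - (0 : Fin d → ℝ) i) ^ 2 ≤ 1 := by
        have := Qf_le z
        have h3 : ∑ i, |z i| ≤ 1 := by
          simp only [hz, Pi.smul_apply, smul_eq_mul, abs_mul, abs_inv]
          rw [← Finset.mul_sum, abs_of_nonneg (by positivity : 0 ≤ ∑ i, |w i|)]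
          exact inv_mul_le_one
        have h4 : 0 ≤ ∑ i, |z i| := by positivity
        simp only [Pi.zero_apply, sub_zero]
        change Qf z ≤ 1
        nlinarith
      have h5 : Real.sqrt (∑ i, (z i - (0 : Fin d → ℝ) i) ^ 2) ≤ 1 := Real.sqrt_le_one.2 h2
      have : |G z| ≤ K := h1.trans (by nlinarith)
      rw [← sq_abs]; gcongr
    calc _ ≤ ∫ w, K ^ 2 ∂lapPi d := integral_mono_of_nonneg
            (Filter.Eventually.of_forall fun w => sq_nonneg _) (by fun_prop)
            (Filter.Eventually.of_forall b)
      _ = K ^ 2 := by simp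
      _ ≤ _ := by
        rw [le_div_iff₀ (by positivity)]
        have : (d:ℝ) ≤ 8 := by exact_mod_cast h8
        have : (d:ℝ) ^ 2 ≤ 64 := by nlinarith
        nlinarith [sq_nonneg K]
  · have h9 : (9:ℝ) ≤ d := by exact_mod_cast (by omega : 9 ≤ d)
    set H : (Fin d → ℝ) → ℝ := fun w => G ((d:ℝ)⁻¹ • w) with hH
    have scale : ∀ (c : ℝ) (v : Fin d → ℝ), Real.sqrt (∑ i, (c * v i) ^ 2)
        = |c| * Real.sqrt (∑ i, v i ^ 2) := fun c v => by
      simp only [mul_pow]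
      rw [← Finset.mul_sum, Real.sqrt_mul (sq_nonneg c), Real.sqrt_sq_eq_abs]
    have hHl : ∀ x y, |H x - H y| ≤ (K / d) * Real.sqrt (∑ i, (x i - y i) ^ 2) := fun x y => by
      refine (hG _ _).trans (le_of_eq ?_)
      simp only [Pi.smul_apply, smul_eq_mul, ← mul_sub]
      rw [scale (d:ℝ)⁻¹ (fun i => x i - y i), abs_of_pos (by positivity)]
      ring
    obtain ⟨C, hC, hv⟩ := lapPi_var d H (K / d) (by positivity) hHl
    have hmean : ∫ w, H w ∂lapPi d = 0 := by
      have h1 := integral_neg_eq_self H (lapPi d)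
      have h2 : ∀ w, H (-w) = - H w := fun w => by simp only [hH, smul_neg, hodd]
      simp only [h2] at h1
      rw [integral_neg] at h1
      linarith
    rw [hmean] at hv
    have iH := lip_int2 hC
    obtain ⟨-, -, m4, -, q2⟩ := moments d
    have iS4 : Integrable (fun w : Fin d → ℝ => Sf w ^ 4) (lapPi d) := by
      simpa using QS_int (d := d) 0 4 (by norm_num)
    have iQS2 : Integrable (fun w : Fin d → ℝ => Qf w * Sf w ^ 2) (lapPi d) := by
      simpa using QS_int (d := d) 1 2 (by norm_num)
    have b : ∀ w : Fin d → ℝ, G ((∑ i, |w i|)⁻¹ • w) ^ 2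
        ≤ 2 * H w ^ 2 + (8 * K ^ 2 / (d:ℝ) ^ 4) * (Qf w * Sf w ^ 2 + Sf w ^ 4) := fun w => by
      have h1 := hG ((∑ i, |w i|)⁻¹ • w) ((d:ℝ)⁻¹ • w)
      simp only [Pi.smul_apply, smul_eq_mul, ← sub_mul] at h1
      rw [scale ((∑ i, |w i|)⁻¹ - (d:ℝ)⁻¹) w] at h1
      have h2 := ptwise hd w
      have h3 : (G ((∑ i, |w i|)⁻¹ • w) - H w) ^ 2
          ≤ K ^ 2 * (((∑ i, |w i|)⁻¹ - (d:ℝ)⁻¹) ^ 2 * Qf w) := by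
        rw [← sq_abs]
        calc _ ≤ (K * (|(∑ i, |w i|)⁻¹ - (d:ℝ)⁻¹| * Real.sqrt (∑ i, w i ^ 2))) ^ 2 := by
              gcongr
          _ = _ := by
            rw [mul_pow, mul_pow, sq_abs, Real.sq_sqrt (by positivity)]; rfl
      have h4 := mul_le_mul_of_nonneg_left h2 (sq_nonneg K)
      have h5 : (8 * K ^ 2 / (d:ℝ) ^ 4) * (Qf w * Sf w ^ 2 + Sf w ^ 4)
        = 2 * (K ^ 2 * (4 / (d:ℝ) ^ 4 * (Qf w * Sf w ^ 2 + Sf w ^ 4))) := by ring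
      rw [h5]
      nlinarith [sq_nonneg (G ((∑ i, |w i|)⁻¹ • w) - 2 * H w)]
    have i1 := iH.const_mul 2
    have i2 := (iQS2.add iS4).const_mul (8 * K ^ 2 / (d:ℝ) ^ 4)
    have e := integral_add i1 i2
    have e2 := integral_add iQS2 iS4
    simp only [Pi.add_apply] at e
    rw [integral_const_mul, integral_const_mul, e2, m4, q2] at e
    calc _ ≤ _ := integral_mono_of_nonneg
            (Filter.Eventually.of_forall fun w => sq_nonneg _) (i1.add i2)
            (Filter.Eventually.of_forall b)
      _ = _ := e
      _ ≤ 2 * (4 * (K / d) ^ 2) + 8 * K ^ 2 / (d:ℝ) ^ 4 *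
          (2 * d ^ 2 + 12 * d + (3 * d ^ 2 + 6 * d)) := by
        gcongr; linarith
      _ = K ^ 2 * (48 * d + 144) / (d:ℝ) ^ 3 := by field_simp; ring
      _ ≤ K ^ 2 * (64 * d) / (d:ℝ) ^ 3 := by gcongr; linarith
      _ = _ := by field_simp

lemma lq_bound {d : ℕ} (hd : 1 ≤ d) (q : ℝ) (hq : 1 ≤ q) (v : Fin d → ℝ) :
    (∑ i, |v i| ^ q) ^ (1 / q)
      ≤ (d:ℝ) ^ (1 / min q 2 - 1 / 2) * Real.sqrt (∑ i, v i ^ 2) := by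
  have hq0 : 0 < q := by linarith
  rcases le_total 2 q with h | h
  · rw [min_eq_right h, sub_self, Real.rpow_zero, one_mul]
    set s := Real.sqrt (∑ i, v i ^ 2) with hs
    have hs0 : 0 ≤ s := Real.sqrt_nonneg _
    have hs2 : s ^ 2 = ∑ i, v i ^ 2 := Real.sq_sqrt (by positivity)
    have hb : ∀ i, |v i| ≤ s := fun i => by
      apply Real.abs_le_sqrt
      exact Finset.single_le_sum (f := fun i => v i ^ 2) (fun i _ => sq_nonneg _) (Finset.mem_univ i)
    have spl : ∀ x : ℝ, 0 ≤ x → x ^ q = x ^ 2 * x ^ (q - 2) := fun x hx => by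
      rw [← Real.rpow_natCast x 2, ← Real.rpow_add_of_nonneg hx (by norm_num) (by linarith)]
      congr 1; push_cast; ring
    have : ∑ i, |v i| ^ q ≤ s ^ q := by
      rw [spl s hs0, hs2, Finset.sum_mul]
      refine Finset.sum_le_sum fun i _ => ?_
      rw [spl _ (abs_nonneg _), sq_abs]
      gcongr
      exact hb i
    calc _ ≤ (s ^ q) ^ (1 / q) := by gcongr
      _ = s := by rw [← Real.rpow_mul hs0, mul_one_div_cancel hq0.ne', Real.rpow_one]
  · rw [min_eq_left h]
    have hp : 1 ≤ 2 / q := by rw [le_div_iff₀ hq0]; linarith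
    have := Real.rpow_sum_le_const_mul_sum_rpow (s := Finset.univ) (f := fun i => |v i| ^ q) hp
    have e1 : ∀ i, |(|v i| ^ q)| ^ (2 / q) = v i ^ 2 := fun i => by
      rw [abs_of_nonneg (by positivity), ← Real.rpow_mul (abs_nonneg _), mul_div_cancel₀ _ hq0.ne',
        Real.rpow_two, sq_abs]
    have e2 : ∀ i, |(|v i| ^ q)| = |v i| ^ q := fun i => abs_of_nonneg (by positivity)
    simp only [e1] at this
    simp only [e2, Finset.card_univ, Fintype.card_fin] at this
    have hA : 0 ≤ ∑ i, |v i| ^ q := by positivity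
    have e3 : (∑ i, |v i| ^ q) ^ (1 / q) = Real.sqrt ((∑ i, |v i| ^ q) ^ (2 / q)) := by
      rw [Real.sqrt_eq_rpow, ← Real.rpow_mul hA]; congr 1; ring
    have e4 : (d:ℝ) ^ (1 / q - 1 / 2) = Real.sqrt ((d:ℝ) ^ (2 / q - 1)) := by
      rw [Real.sqrt_eq_rpow, ← Real.rpow_mul (by positivity)]; congr 1; ring
    rw [e3, e4, ← Real.sqrt_mul (by positivity)]
    exact Real.sqrt_le_sqrt this


lemma norm_sign {d : ℕ} (hd : 1 ≤ d) (r : ℝ≥0∞) [Fact (1 ≤ r)] (c : ℝ) (z : Fin d → ℝ) :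
    ‖(WithLp.equiv r (Fin d → ℝ)).symm (c • signVec z)‖ = |c| * (d:ℝ) ^ (1 / r.toReal) := by
  have hab : ∀ i, |(c • signVec z) i| = |c| := fun i => by
    simp only [Pi.smul_apply, smul_eq_mul, signVec, abs_mul]
    split_ifs <;> simp
  have hr1 : 1 ≤ r := Fact.out
  by_cases hr : r = ⊤
  · subst hr
    have : Nonempty (Fin d) := ⟨⟨0, hd⟩⟩
    rw [PiLp.norm_eq_ciSup]
    have : ∀ i, ‖((WithLp.equiv ⊤ (Fin d → ℝ)).symm (c • signVec z)) i‖ = |c| := hab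
    simp only [this]
    simp
  · have h0 : 0 < r.toReal := ENNReal.toReal_pos (by positivity) hr
    rw [PiLp.norm_eq_sum h0]
    have : ∀ i, ‖((WithLp.equiv r (Fin d → ℝ)).symm (c • signVec z)) i‖ = |c| := hab
    simp only [this]
    simp only [Finset.sum_const, Finset.card_univ, Fintype.card_fin, nsmul_eq_mul]
    rw [Real.mul_rpow (by positivity) (by positivity), ← Real.rpow_mul (abs_nonneg _),
      mul_one_div_cancel h0.ne', Real.rpow_one, mul_comm]

/-- Let `d ≥ 3`, `p ∈ [1, ∞]` with conjugate `p*`, `f` `L`-Lipschitz w.r.t. ℓ_q, `h > 0`,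
`ζ` uniform on the ℓ¹-sphere, and `g = (d/(2h))(f(x + hζ) - f(x - hζ)) sign(ζ)`. Then
`E[‖g‖_{p*}²] ≤ 12 (1 + √2)² L² d^{1 + 2/(q∧2) - 2/p}` (with the convention `1/∞ = 0`). -/
theorem gradient_estimator_second_moment (d : ℕ) (hd : 3 ≤ d)
    (p pStar : ℝ≥0∞) (hp : 1 ≤ p) [Fact (1 ≤ pStar)] (hconj : 1 / p + 1 / pStar = 1)
    (q : ℝ) (hq : 1 ≤ q) (f : (Fin d → ℝ) → ℝ) (L : ℝ) (hL : 0 ≤ L)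
    (hf : ∀ x y, |f x - f y| ≤ L * (∑ i, |x i - y i| ^ q) ^ (1 / q))
    (x : Fin d → ℝ) (h : ℝ) (hh : 0 < h) :
    (∫ ζ, ‖(WithLp.equiv pStar (Fin d → ℝ)).symm
          (((d : ℝ) / (2 * h) * (f (x + h • ζ) - f (x - h • ζ))) • signVec ζ)‖ ^ 2
        ∂sphereUniform d) ≤
      12 * (1 + Real.sqrt 2) ^ 2 * L ^ 2 * (d : ℝ) ^ (1 + 2 / min q 2 - 2 / p.toReal) := by
  have hd1 : 1 ≤ d := by omega
  have hd0 : (0:ℝ) < d := by exact_mod_cast hd1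
  set G : (Fin d → ℝ) → ℝ := fun z => f (x + h • z) - f (x - h • z) with hGdef
  set D : ℝ := (d:ℝ) ^ (1 / min q 2 - 1 / 2) with hD
  have hD0 : 0 < D := by positivity
  have hf2 : ∀ x y, |f x - f y| ≤ L * D * Real.sqrt (∑ i, (x i - y i) ^ 2) := fun x y => by
    refine (hf x y).trans ?_
    rw [mul_assoc]
    gcongr
    exact lq_bound hd1 q hq (fun i => x i - y i)
  have scale : ∀ (c : ℝ) (v : Fin d → ℝ), Real.sqrt (∑ i, (c * v i) ^ 2)
      = |c| * Real.sqrt (∑ i, v i ^ 2) := fun c v => by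
    simp only [mul_pow]
    rw [← Finset.mul_sum, Real.sqrt_mul (sq_nonneg c), Real.sqrt_sq_eq_abs]
  have hG : ∀ y z, |G y - G z| ≤ (2 * L * h * D) * Real.sqrt (∑ i, (y i - z i) ^ 2) := fun y z => by
    have h1 := hf2 (x + h • y) (x + h • z)
    have h2 := hf2 (x - h • y) (x - h • z)
    have e1 : ∀ i, (x + h • y) i - (x + h • z) i = h * (y i - z i) := fun i => by
      simp; ring
    have e2 : ∀ i, (x - h • y) i - (x - h • z) i = (-h) * (y i - z i) := fun i => by
      simp; ring
    simp only [e1] at h1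
    simp only [e2] at h2
    rw [scale h (fun i => y i - z i), abs_of_pos hh] at h1
    rw [scale (-h) (fun i => y i - z i), abs_neg, abs_of_pos hh] at h2
    have h3 : G y - G z = (f (x + h • y) - f (x + h • z)) - (f (x - h • y) - f (x - h • z)) := by
      simp only [hGdef]; ring
    rw [h3]
    refine (abs_sub _ _).trans ?_
    linarith
  have hodd : ∀ z, G (-z) = - G z := fun z => by
    simp only [hGdef, smul_neg, sub_neg_eq_add, ← sub_eq_add_neg]; ring
  have hcore := core hd1 G (2 * L * h * D) (by positivity) hG hodd
  obtain ⟨C, hC, -⟩ := lapPi_var d G (2 * L * h * D) (by positivity) hG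
  have hGc := hC.continuous
  have hI : ∫ ζ, ‖(WithLp.equiv pStar (Fin d → ℝ)).symm
          (((d : ℝ) / (2 * h) * (f (x + h • ζ) - f (x - h • ζ))) • signVec ζ)‖ ^ 2
        ∂sphereUniform d
      = ((d : ℝ) / (2 * h) * (d:ℝ) ^ (1 / pStar.toReal)) ^ 2 *
        ∫ w, G ((∑ i, |w i|)⁻¹ • w) ^ 2 ∂lapPi d := by
    simp only [norm_sign hd1]
    have : ∀ ζ, (|(d : ℝ) / (2 * h) * (f (x + h • ζ) - f (x - h • ζ))|
        * (d:ℝ) ^ (1 / pStar.toReal)) ^ 2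
        = ((d : ℝ) / (2 * h) * (d:ℝ) ^ (1 / pStar.toReal)) ^ 2 * G ζ ^ 2 := fun ζ => by
      rw [mul_pow, sq_abs]; simp only [hGdef]; ring
    simp only [this]
    rw [integral_const_mul]
    congr 1
    unfold sphereUniform
    rw [integral_map]
    · have hm : Measurable (fun w : Fin d → ℝ => (∑ i, |w i|)⁻¹) := by fun_prop
      exact (hm.smul measurable_id).aemeasurable
    · exact (hGc.pow 2).aestronglyMeasurable
  rw [hI]
  have hexp : 1 / p.toReal + 1 / pStar.toReal = 1 := by
    have ha : 1 / p ≠ ⊤ := fun hc => by rw [hc] at hconj; simp at hconj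
    have hb : 1 / pStar ≠ ⊤ := fun hc => by rw [hc] at hconj; simp at hconj
    have := congrArg ENNReal.toReal hconj
    rw [ENNReal.toReal_add ha hb] at this
    simpa using this
  have hpow : ((d:ℝ) ^ (1 / pStar.toReal)) ^ 2 * D ^ 2
      = (d:ℝ) ^ (1 + 2 / min q 2 - 2 / p.toReal) := by
    rw [hD, ← mul_pow, ← Real.rpow_add hd0, ← Real.rpow_natCast, ← Real.rpow_mul hd0.le]
    congr 1
    have : 1 / pStar.toReal = 1 - 1 / p.toReal := by linarith
    rw [this]; push_cast; ring
  have hs : (64:ℝ) ≤ 12 * (1 + Real.sqrt 2) ^ 2 := by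
    have : (1.4:ℝ) ≤ Real.sqrt 2 := Real.le_sqrt_of_sq_le (by norm_num)
    nlinarith
  calc _ ≤ ((d : ℝ) / (2 * h) * (d:ℝ) ^ (1 / pStar.toReal)) ^ 2 *
        (64 * (2 * L * h * D) ^ 2 / (d:ℝ) ^ 2) := by gcongr
    _ = 64 * L ^ 2 * (((d:ℝ) ^ (1 / pStar.toReal)) ^ 2 * D ^ 2) := by
      field_simp
    _ = 64 * L ^ 2 * (d:ℝ) ^ (1 + 2 / min q 2 - 2 / p.toReal) := by rw [hpow]
    _ ≤ _ := by gcongr
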